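/- arXiv:1607.02066 — 2 statements merged into one kernel-verified Lean document; each statement's English description precedes it below -/
import Mathlib

section
/- Let a, b, τ ∈ ℝ, and define W_m = (a)_{m−1↑τ} for m ∈ ℕ and U_m = (b)_{m↑τ} for m ∈ ℕ₀. Then for every n ∈ ℕ, k ∈ ℕ₀, and all integers m₁,…,m_k with 1 ≤ mᵢ ≤ n, Σ_{z ∈ {0,1}^k} ∏_{i=1}^{k} W_{mᵢ+zᵢ} U_{n+1−mᵢ−zᵢ} = (a+b+τ(n−1))^k · ∏_{i=1}^{k} W_{mᵢ} U_{n−mᵢ}. (Key identity in the proof of Proposition 2.1.) -/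
open scoped BigOperators

/-- Generalized rising factorial `(x)_{j↑τ} = x(x+τ)⋯(x+(j-1)τ)`. -/
noncomputable def risingFacTau (x τ : ℝ) (j : ℕ) : ℝ :=
  ∏ i ∈ Finset.range j, (x + i * τ)

theorem risingFacTau_succ (x τ : ℝ) (j : ℕ) :
    risingFacTau x τ (j + 1) = risingFacTau x τ j * (x + j * τ) :=
  Finset.prod_range_succ _ _

/-- The one-factor case of the identity. -/
theorem sum_fin_two_risingFacTau_mul (a b τ : ℝ) {n m : ℕ} (hm : 1 ≤ m) (hmn : m ≤ n) :
    ∑ z : Fin 2, risingFacTau a τ (m + (z : ℕ) - 1) * risingFacTau b τ (n + 1 - m - (z : ℕ)) =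
      (a + b + τ * ((n : ℝ) - 1)) * (risingFacTau a τ (m - 1) * risingFacTau b τ (n - m)) := by
  obtain ⟨p, rfl⟩ := Nat.exists_eq_add_of_le' hm
  obtain ⟨q, rfl⟩ := Nat.exists_eq_add_of_le hmn
  have h₁ : p + 1 + q + 1 - (p + 1) = q + 1 := by omega
  have h₂ : p + 1 + q - (p + 1) = q := by omega
  simp only [Fin.sum_univ_two, Fin.val_zero, Fin.val_one, h₁, h₂, Nat.add_sub_cancel,
    Nat.add_zero, Nat.sub_zero, risingFacTau_succ]
  push_cast
  ring

/-- Key identity in the proof of Proposition 2.1: with `W_m = (a)_{m-1↑τ}` and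
`U_m = (b)_{m↑τ}`, the sum over `z ∈ {0,1}^k` collapses to a power. -/
theorem stmt_2
    (a b τ : ℝ) (n : ℕ) (hn : 1 ≤ n) (k : ℕ) (m : Fin k → ℕ)
    (hm : ∀ i, 1 ≤ m i ∧ m i ≤ n) :
    ∑ z : Fin k → Fin 2,
        ∏ i, risingFacTau a τ (m i + (z i : ℕ) - 1) *
          risingFacTau b τ (n + 1 - m i - (z i : ℕ)) =
      (a + b + τ * ((n : ℝ) - 1)) ^ k *
        ∏ i, risingFacTau a τ (m i - 1) * risingFacTau b τ (n - m i) := by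
  rw [← Fintype.prod_sum fun i (z : Fin 2) =>
      risingFacTau a τ (m i + (z : ℕ) - 1) * risingFacTau b τ (n + 1 - m i - (z : ℕ)),
    Finset.prod_congr rfl fun i _ => sum_fin_two_risingFacTau_mul a b τ (hm i).1 (hm i).2,
    Finset.prod_mul_distrib, Finset.prod_const, Finset.card_univ, Fintype.card_fin]
end

section
/- Fix a real number θ > 0 and set α = 0. A map V : ℕ × ℕ₀ → [0,∞) is a (0,θ)-solution if and only if there exists a Borel probability measure μ on [0,∞) such that V_{n,k} = ∫_{[0,∞)} V^{IBP,0,θ}_{n,k}(γ) μ(dγ) for all n ∈ ℕ and k ∈ ℕ₀. (Theorem 1.1, case α = 0: the solutions are exactly the mixtures over γ of the two-parameter Indian Buffet Process weights.) -/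
open scoped BigOperators
open MeasureTheory

/-- Rising factorial `(x)_{j↑} = x(x+1)⋯(x+j-1)`. -/
noncomputable def risingFac (x : ℝ) (j : ℕ) : ℝ :=
  ∏ i ∈ Finset.range j, (x + i)

/-- `V` is an `(α,θ)`-solution of the consistency recursion. -/
def IsSolution (α θ : ℝ) (V : ℕ → ℕ → ℝ) : Prop :=
  HasSum (fun j => V 1 j) 1 ∧
  ∀ n : ℕ, 1 ≤ n → ∀ k : ℕ,
    HasSum
      (fun j : ℕ =>
        (Nat.choose (k + j) j : ℝ) * (risingFac (θ + α) n) ^ j *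
          (θ + (n : ℝ)) ^ k * V (n + 1) (k + j))
      (V n k)

/-- Indian Buffet Process weights `V^{IBP,α,θ}_{n,k}(γ)`. -/
noncomputable def VIBP (α θ γ : ℝ) (n k : ℕ) : ℝ :=
  (1 / (Nat.factorial k : ℝ)) * (γ / risingFac (θ + 1) (n - 1)) ^ k *
    Real.exp (-(∑ i ∈ Finset.Icc 1 n,
      γ * risingFac (α + θ) (i - 1) / risingFac (1 + θ) (i - 1)))

open Filter Topology Nat

/-- A series of nonnegative reals, summed in `ℝ≥0∞`. -/
lemma hasSum_iff_tsum_ofReal_eq {ι : Type*} {f : ι → ℝ} {s : ℝ} (hf : ∀ i, 0 ≤ f i) (hs : 0 ≤ s) :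
    HasSum f s ↔ ∑' i, ENNReal.ofReal (f i) = ENNReal.ofReal s := by
  constructor
  · intro h
    rw [← ENNReal.ofReal_tsum_of_nonneg hf h.summable, h.tsum_eq]
  · intro h
    have hsum : Summable f := by
      have := ENNReal.summable_toReal (f := fun i => ENNReal.ofReal (f i)) (by simp [h])
      simpa [ENNReal.toReal_ofReal (hf _)] using this
    rw [← ENNReal.ofReal_tsum_of_nonneg hf hsum,
      ENNReal.ofReal_eq_ofReal_iff (tsum_nonneg hf) hs] at h
    exact h ▸ hsum.hasSum

/-- The coefficients of a power series are determined by its sums on `[0, r)`. -/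
lemma coeff_eq_of_hasSum_eq {a b : ℕ → ℝ} {r : ℝ} (hr : 0 < r) {s : ℝ → ℝ}
    (ha : ∀ z, 0 ≤ z → z < r → HasSum (fun k => a k * z ^ k) (s z))
    (hb : ∀ z, 0 ≤ z → z < r → HasSum (fun k => b k * z ^ k) (s z)) : a = b := by
  set c : ℕ → ℝ := fun k => a k - b k
  have hc : ∀ z, 0 ≤ z → z < r → HasSum (fun k => c k * z ^ k) 0 := fun z h0 h1 => by
    simpa [c, sub_mul] using (ha z h0 h1).sub (hb z h0 h1)
  set p := FormalMultilinearSeries.ofScalars ℝ c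
  have hrad : 0 < p.radius := by
    have hle : (((r / 2).toNNReal : NNReal) : ENNReal) ≤ p.radius := by
      apply p.le_radius_of_summable
      refine ((hc (r / 2) (by positivity) (by linarith)).summable.norm).congr fun k => ?_
      rw [FormalMultilinearSeries.ofScalars_norm, norm_mul, norm_pow]
      rw [Real.coe_toNNReal _ (by positivity), Real.norm_of_nonneg (by positivity : 0 ≤ r / 2)]
    refine lt_of_lt_of_le ?_ hle
    simpa using hr
  have hp : HasFPowerSeriesAt p.sum p 0 := (p.hasFPowerSeriesOnBall hrad).hasFPowerSeriesAt
  have hp0 : p = 0 := by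
    by_contra hne
    have h1 : ∀ᶠ z in 𝓝[>] (0 : ℝ), p.sum z ≠ 0 :=
      (hp.locally_ne_zero hne).filter_mono (nhdsWithin_mono _ fun z hz => ne_of_gt hz)
    have h2 : ∀ᶠ z in 𝓝[>] (0 : ℝ), z ∈ Set.Ioo 0 r := Ioo_mem_nhdsGT hr
    obtain ⟨z, hz1, hz2⟩ := (h1.and h2).exists
    apply hz1
    have : p.sum z = ∑' n, c n • z ^ n := FormalMultilinearSeries.ofScalars_sum_eq c z
    rw [this]
    simpa using (hc z hz2.1.le hz2.2).tsum_eq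
  have hc0 : c = 0 := (FormalMultilinearSeries.ofScalars_series_eq_zero (E := ℝ) (c := c)).1 hp0
  funext k
  exact sub_eq_zero.1 (congrFun hc0 k)

/-- The exponential generating function of a nonnegative sequence, with values in `ℝ≥0∞`. -/
noncomputable def expGenFun (w : ℕ → ℝ) (z : ℝ) : ENNReal :=
  ∑' k, ENNReal.ofReal (w k * z ^ k / k !)

/-- If `v` is the sequence of Taylor coefficients of the generating function of `w` at `c`, then
the generating function of `v` is that of `w` shifted by `c`. -/
lemma expGenFun_shift {v w : ℕ → ℝ} {c z : ℝ} (hc : 0 ≤ c) (hz : 0 ≤ z)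
    (hv : ∀ k, 0 ≤ v k) (hw : ∀ k, 0 ≤ w k)
    (h : ∀ k, HasSum (fun j => c ^ j / j ! * w (k + j)) (v k)) :
    expGenFun v z = expGenFun w (z + c) := by
  have h1 : ∀ k, ENNReal.ofReal (v k * z ^ k / k !) =
      ∑' j, ENNReal.ofReal (c ^ j / j ! * w (k + j) * (z ^ k / k !)) := fun k => by
    have := (h k).mul_right (z ^ k / k !)
    have hvk := hv k
    have hnn : ∀ j, 0 ≤ c ^ j / j ! * w (k + j) * (z ^ k / k !) := fun j => by
      have := hw (k + j)
      positivity
    rw [(hasSum_iff_tsum_ofReal_eq hnn (by positivity)).1 this, mul_div_assoc]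
  unfold expGenFun
  simp_rw [h1]
  rw [← ENNReal.tsum_prod (f := fun k j => ENNReal.ofReal (c ^ j / j ! * w (k + j) * (z ^ k / k !))),
    ← Finset.HasAntidiagonal.sigmaAntidiagonalEquivProd.tsum_eq, ENNReal.tsum_sigma']
  refine tsum_congr fun l => ?_
  rw [tsum_fintype]
  simp only [Finset.HasAntidiagonal.sigmaAntidiagonalEquivProd_apply]
  rw [Finset.sum_coe_sort (Finset.HasAntidiagonal.antidiagonal l) (fun x : ℕ × ℕ =>
    ENNReal.ofReal (c ^ x.2 / x.2 ! * w (x.1 + x.2) * (z ^ x.1 / x.1 !))),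
    ← ENNReal.ofReal_sum_of_nonneg]
  · congr 1
    rw [(Commute.all z c).add_pow', Finset.mul_sum, Finset.sum_div]
    refine Finset.sum_congr rfl fun x hx => ?_
    obtain rfl := Finset.HasAntidiagonal.mem_antidiagonal.1 hx
    have h3 : ((x.1 + x.2).choose x.1 : ℝ) * x.1 ! * x.2 ! = (x.1 + x.2)! := by
      rw [Nat.choose_symm_add]
      exact_mod_cast Nat.add_choose_mul_factorial_mul_factorial x.1 x.2
    rw [← h3, nsmul_eq_mul]
    have : ((x.1 + x.2).choose x.1 : ℝ) ≠ 0 := by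
      exact_mod_cast (Nat.choose_pos (Nat.le_add_right _ _)).ne'
    field_simp
  · intro x _
    have := hw (x.1 + x.2)
    positivity

/-- `(1 - y) ^ l` approximates `exp (-l y)` uniformly in `l`. -/
lemma abs_exp_neg_pow_sub_le {y : ℝ} (hy0 : 0 ≤ y) (hy1 : y ≤ 1) (l : ℕ) :
    |Real.exp (-y) ^ l - (1 - y) ^ l| ≤ y := by
  have hqr : 1 - y ≤ Real.exp (-y) := Real.one_sub_le_exp_neg y
  have hlow : (1 - y) ^ l ≤ Real.exp (-y) ^ l := pow_le_pow_left₀ (by linarith) hqr l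
  rw [abs_of_nonneg (by linarith)]
  clear hlow
  induction l with
  | zero => simpa using hy0
  | succ l ih =>
    have h1 : (1 - y) ^ l ≤ 1 := pow_le_one₀ (by linarith) (by linarith)
    have h2 : Real.exp (-y) * (y + 1) ≤ 1 := by
      rw [Real.exp_neg, inv_mul_le_one₀ (Real.exp_pos y)]
      exact Real.add_one_le_exp y
    have h3 := mul_le_mul_of_nonneg_left ih (Real.exp_pos (-y)).le
    have h4 := mul_le_mul_of_nonneg_right h1 (sub_nonneg.2 hqr)
    rw [pow_succ, pow_succ]
    nlinarith

lemma integrable_pow_mul_exp_neg {μ : Measure ℝ} [IsFiniteMeasure μ] (hμ : μ (Set.Iio 0) = 0)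
    {h : ℝ} (hh : 0 < h) (k : ℕ) : Integrable (fun x => x ^ k * Real.exp (-(h * x))) μ := by
  have hae : ∀ᵐ x ∂μ, 0 ≤ x := by
    rw [ae_iff]; simpa [Set.Iio] using hμ
  refine Integrable.of_bound (C := k ! / h ^ k) (by fun_prop) ?_
  filter_upwards [hae] with x hx
  have h1 := Real.pow_div_factorial_le_exp (h * x) (mul_nonneg hh.le hx) k
  rw [Real.norm_of_nonneg (by positivity), Real.exp_neg, ← div_eq_mul_inv,
    div_le_div_iff₀ (Real.exp_pos _) (by positivity)]
  rw [div_le_iff₀ (by positivity), mul_pow] at h1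
  linarith

/-- Expanding `exp (d x)` under the integral sign. -/
lemma hasSum_integral_pow_mul_exp_neg {μ : Measure ℝ} (hμ : μ (Set.Iio 0) = 0)
    {h d : ℝ} (hd : 0 ≤ d) {k : ℕ} (hi : Integrable (fun x => x ^ k * Real.exp (-(h * x))) μ) :
    HasSum (fun j => d ^ j / j ! * ∫ x, x ^ (k + j) * Real.exp (-((h + d) * x)) ∂μ)
      (∫ x, x ^ k * Real.exp (-(h * x)) ∂μ) := by
  have hae : ∀ᵐ x ∂μ, 0 ≤ x := by
    rw [ae_iff]; simpa [Set.Iio] using hμ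
  have hsum : ∀ x : ℝ, HasSum (fun j => d ^ j / j ! * (x ^ (k + j) * Real.exp (-((h + d) * x))))
      (x ^ k * Real.exp (-(h * x))) := fun x => by
    have h1 := NormedSpace.expSeries_div_hasSum_exp (d * x)
    rw [← Real.exp_eq_exp_ℝ] at h1
    have h2 := h1.mul_left (x ^ k * Real.exp (-((h + d) * x)))
    convert! h2 using 1
    · funext j
      rw [mul_pow, pow_add]
      ring
    · rw [mul_assoc, ← Real.exp_add]
      ring_nf
  simp_rw [← integral_const_mul]
  refine hasSum_integral_of_dominated_convergence
    (fun j x => d ^ j / j ! * (x ^ (k + j) * Real.exp (-((h + d) * x))))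
    (fun j => by fun_prop) (fun j => ?_) (ae_of_all _ fun x => (hsum x).summable) ?_
    (ae_of_all _ hsum)
  · filter_upwards [hae] with x hx
    rw [Real.norm_of_nonneg (by positivity)]
  · simpa only [(hsum _).tsum_eq] using hi

/-- The measure on `ℝ` obtained from a measure on `[0, 1]` by discarding the mass at `0` and
applying `u ↦ - log u`. -/
noncomputable def negLogMeasure (μ : Measure unitInterval) : Measure ℝ :=
  (μ.restrict {u | 0 < (u : ℝ)}).map fun u : unitInterval => -Real.log (u : ℝ)

lemma measurable_neg_log_unitInterval :
    Measurable fun u : unitInterval => -Real.log (u : ℝ) :=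
  (Real.measurable_log.comp measurable_subtype_coe).neg

lemma measurableSet_pos_unitInterval : MeasurableSet {u : unitInterval | 0 < (u : ℝ)} :=
  measurableSet_lt measurable_const measurable_subtype_coe

instance (μ : Measure unitInterval) [IsFiniteMeasure μ] : IsFiniteMeasure (negLogMeasure μ) := by
  unfold negLogMeasure
  infer_instance

lemma negLogMeasure_Iio (μ : Measure unitInterval) : negLogMeasure μ (Set.Iio 0) = 0 := by
  rw [negLogMeasure, Measure.map_apply measurable_neg_log_unitInterval measurableSet_Iio]
  convert measure_empty (μ := μ.restrict {u | 0 < (u : ℝ)})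
  ext u
  simpa using Real.log_nonpos u.2.1 u.2.2

lemma integral_exp_neg_negLogMeasure (μ : Measure unitInterval) {x : ℝ} (hx : 0 < x) :
    ∫ g, Real.exp (-(x * g)) ∂negLogMeasure μ = ∫ u : unitInterval, (u : ℝ) ^ x ∂μ := by
  rw [negLogMeasure, integral_map measurable_neg_log_unitInterval.aemeasurable (by fun_prop)]
  have hzero : ∀ u : unitInterval, u ∉ {u : unitInterval | 0 < (u : ℝ)} → (u : ℝ) ^ x = 0 :=
    fun u hu => by
      have : (u : ℝ) = 0 := le_antisymm (not_lt.1 hu) u.2.1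
      rw [this, Real.zero_rpow hx.ne']
  rw [← setIntegral_eq_integral_of_forall_compl_eq_zero hzero]
  refine setIntegral_congr_fun measurableSet_pos_unitInterval fun u hu => ?_
  have hu' : 0 < (u : ℝ) := hu
  simp only [Real.rpow_def_of_pos hu']
  ring_nf

/-- The point `exp (-l / H)` of the unit interval. -/
noncomputable def expNegDiv (H : ℝ) (l : ℕ) : unitInterval :=
  ⟨Real.exp (-(l / |H|)), (Real.exp_pos _).le, Real.exp_le_one_iff.2 (by
    simp only [Left.neg_nonpos_iff]; positivity)⟩

/-- A family `W n` of nonnegative Taylor coefficients, at points `-h n` going to `-∞`, of a single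
function is represented by a probability measure (a discrete form of Bernstein's theorem). -/
theorem exists_measure_of_expGenFun {W : ℕ → ℕ → ℝ} {h : ℕ → ℝ} (hW : ∀ n k, 0 ≤ W n k)
    (hpos : ∀ n, 0 < h n) (hmono : Monotone h) (hlim : Tendsto h atTop atTop)
    (hone : expGenFun (W 0) (h 0) = 1)
    (hrec : ∀ n k, HasSum (fun j => (h (n + 1) - h n) ^ j / j ! * W (n + 1) (k + j)) (W n k)) :
    ∃ μ : Measure ℝ, IsProbabilityMeasure μ ∧ μ (Set.Iio 0) = 0 ∧
      ∀ n k, W n k = ∫ x, x ^ k * Real.exp (-(h n * x)) ∂μ := by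
  have hshift : ∀ m n, m ≤ n → ∀ z, 0 ≤ z →
      expGenFun (W m) z = expGenFun (W n) (z + (h n - h m)) := by
    intro m n hmn
    induction n, hmn using Nat.le_induction with
    | base => simp
    | succ n hmn ih =>
      intro z hz
      have := hmono hmn
      rw [ih z hz, expGenFun_shift (sub_nonneg.2 (hmono n.le_succ)) (by linarith) (hW n)
        (hW (n + 1)) (hrec n)]
      congr 1
      ring
  have hmass : ∀ n, expGenFun (W n) (h n) = 1 := fun n => by
    rw [← hone, hshift 0 n n.zero_le _ (hpos 0).le]
    congr 1
    ring
  let q : ℕ → PMF ℕ := fun n =>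
    ⟨fun l => ENNReal.ofReal (W n l * h n ^ l / l !), by
      rw [← hmass n]; exact ENNReal.summable.hasSum⟩
  have hq : ∀ n l, ((q n) l).toReal = W n l * h n ^ l / l ! := fun n l =>
    ENNReal.toReal_ofReal (by have := hW n l; have := hpos n; positivity)
  let P : ℕ → ProbabilityMeasure unitInterval := fun n =>
    ⟨(q n).toMeasure.map (expNegDiv (h n)),
      Measure.isProbabilityMeasure_map (measurable_of_countable _).aemeasurable⟩
  let U : Ultrafilter ℕ := hyperfilter ℕ
  have hU : (U : Filter ℕ) ≤ atTop := by
    rw [← Nat.cofinite_eq_atTop]; exact hyperfilter_le_cofinite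
  let Q := (U.map P).lim
  have hQ : Tendsto P U (𝓝 Q) := (U.map P).le_nhds_lim
  rw [ProbabilityMeasure.tendsto_iff_forall_integral_tendsto] at hQ
  -- the Laplace transform of the limit measure
  have hlap : ∀ m z, 0 ≤ z → z < h m → HasSum (fun k => W m k * z ^ k / k !)
      (∫ u : unitInterval, (u : ℝ) ^ (h m - z) ∂(Q : Measure unitInterval)) := by
    intro m z hz0 hzm
    set x := h m - z with hx
    have hx0 : 0 < x := sub_pos.2 hzm
    let f : C(unitInterval, ℝ) := ⟨fun u => (u : ℝ) ^ x, by
      exact continuous_subtype_val.rpow_const fun _ => Or.inr hx0.le⟩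
    have h1 := hQ (BoundedContinuousFunction.mkOfCompact f)
    have h2 : ∀ n, ∫ u, (BoundedContinuousFunction.mkOfCompact f) u ∂(P n : Measure unitInterval) =
        ∫ l, Real.exp (-(x / h n)) ^ l ∂(q n).toMeasure := fun n => by
      change ∫ u, f u ∂((q n).toMeasure.map (expNegDiv (h n))) = _
      rw [integral_map (measurable_of_countable _).aemeasurable
        f.continuous.aestronglyMeasurable]
      refine integral_congr_ae (ae_of_all _ fun l => ?_)
      change Real.exp (-(l / |h n|)) ^ x = _
      rw [← Real.exp_mul, ← Real.exp_nat_mul, abs_of_pos (hpos n)]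
      ring_nf
    have hle : ∀ n, m ≤ n → x / h n ∈ Set.Icc (0 : ℝ) 1 := fun n hn =>
      ⟨(div_pos hx0 (hpos n)).le, (div_le_one (hpos n)).2 (by linarith [hmono hn])⟩
    have h_int : ∀ n (y : ℝ), y ∈ Set.Icc (0 : ℝ) 1 →
        Integrable (fun l : ℕ => y ^ l) (q n).toMeasure := fun n y hy =>
      Integrable.of_bound (C := 1) (measurable_of_countable _).aestronglyMeasurable
        (ae_of_all _ fun l => by
          rw [Real.norm_of_nonneg (pow_nonneg hy.1 l)]; exact pow_le_one₀ hy.1 hy.2)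
    -- the generating function as an integral over the discrete measures
    have h3 : ∀ n, m ≤ n → expGenFun (W m) z =
        ENNReal.ofReal (∫ l, (1 - x / h n) ^ l ∂(q n).toMeasure) := fun n hn => by
      have hy := hle n hn
      have hi := h_int n (1 - x / h n) ⟨by linarith [hy.2], by linarith [hy.1]⟩
      rw [hshift m n hn z hz0, PMF.integral_eq_tsum _ _ hi]
      have hterm : ∀ l, ((q n) l).toReal • (1 - x / h n) ^ l =
          W n l * (z + (h n - h m)) ^ l / l ! := fun l => by
        have hz : z + (h n - h m) = h n * (1 - x / h n) := by
          have := (hpos n).ne'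
          field_simp
          rw [hx]; ring
        rw [hq, hz, mul_pow, smul_eq_mul]
        ring
      have hnn : ∀ l, 0 ≤ W n l * (z + (h n - h m)) ^ l / l ! := fun l => by
        have := hW n l
        have : 0 ≤ z + (h n - h m) := by linarith [hmono hn]
        positivity
      simp_rw [hterm]
      rw [ENNReal.ofReal_tsum_of_nonneg hnn]
      · rfl
      · have hfin : expGenFun (W n) (z + (h n - h m)) ≠ ⊤ := by
          refine ne_top_of_le_ne_top ENNReal.one_ne_top ((hmass n).symm ▸ ?_)
          refine ENNReal.tsum_le_tsum fun l => ENNReal.ofReal_le_ofReal ?_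
          have := hW n l
          have : 0 ≤ z + (h n - h m) := by linarith [hmono hn]
          gcongr
          linarith
        have := ENNReal.summable_toReal hfin
        simpa only [ENNReal.toReal_ofReal (hnn _)] using this
    have h4 : ∀ᶠ n in (U : Filter ℕ),
        ‖∫ l, Real.exp (-(x / h n)) ^ l ∂(q n).toMeasure - (expGenFun (W m) z).toReal‖
          ≤ x / h n := by
      filter_upwards [hU (eventually_ge_atTop m)] with n hn
      have hy := hle n hn
      have hy' : 1 - x / h n ∈ Set.Icc (0 : ℝ) 1 := ⟨by linarith [hy.2], by linarith [hy.1]⟩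
      rw [h3 n hn, ENNReal.toReal_ofReal (integral_nonneg fun l => pow_nonneg hy'.1 l),
        ← integral_sub (h_int n _ ⟨(Real.exp_pos _).le,
          Real.exp_le_one_iff.2 (neg_nonpos.2 hy.1)⟩) (h_int n _ hy')]
      refine (norm_integral_le_of_norm_le_const (C := x / h n)
        (ae_of_all _ fun l => abs_exp_neg_pow_sub_le hy.1 hy.2 l)).trans_eq ?_
      simp
    have h5 : Tendsto (fun n => x / h n) U (𝓝 0) :=
      (hlim.mono_left hU).const_div_atTop x
    have h6 : Tendsto (fun n => ∫ l, Real.exp (-(x / h n)) ^ l ∂(q n).toMeasure) U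
        (𝓝 (expGenFun (W m) z).toReal) := by
      rw [tendsto_iff_norm_sub_tendsto_zero]
      exact squeeze_zero' (Eventually.of_forall fun _ => norm_nonneg _) h4 h5
    simp_rw [h2] at h1
    have h7 := tendsto_nhds_unique h1 h6
    have h8 : ∫ u : unitInterval, (u : ℝ) ^ x ∂(Q : Measure unitInterval) =
      (expGenFun (W m) z).toReal := h7
    rw [h8, hasSum_iff_tsum_ofReal_eq _ ENNReal.toReal_nonneg, ENNReal.ofReal_toReal]
    · rfl
    · rw [h3 m le_rfl]; exact ENNReal.ofReal_ne_top
    · intro k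
      have := hW m k
      positivity
  set ν := negLogMeasure (Q : Measure unitInterval) with hν
  have hν0 : ν (Set.Iio 0) = 0 := negLogMeasure_Iio _
  have hWν : ∀ n k, W n k = ∫ x, x ^ k * Real.exp (-(h n * x)) ∂ν := by
    intro n
    have key := coeff_eq_of_hasSum_eq (hpos n)
      (a := fun k => W n k / k !)
      (b := fun k => (∫ x, x ^ k * Real.exp (-(h n * x)) ∂ν) / k !)
      (s := fun z => ∫ x, Real.exp (-((h n - z) * x)) ∂ν) (fun z hz0 hz1 => ?_)
      (fun z hz0 hz1 => ?_)
    · intro k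
      have h1 := congrFun key k
      have h2 : (k ! : ℝ) ≠ 0 := by positivity
      simpa [div_left_inj' h2] using h1
    · rw [hν, integral_exp_neg_negLogMeasure _ (sub_pos.2 hz1)]
      convert hlap n z hz0 hz1 using 2
      ring
    · have h1 := hasSum_integral_pow_mul_exp_neg hν0 hz0 (h := h n - z) (k := 0)
        (integrable_pow_mul_exp_neg hν0 (sub_pos.2 hz1) 0)
      simp only [pow_zero, one_mul, zero_add, sub_add_cancel] at h1
      convert h1 using 2
      ring
  refine ⟨ν, ⟨?_⟩, hν0, hWν⟩
  have h1 := hasSum_integral_pow_mul_exp_neg hν0 (hpos 0).le (h := 0) (k := 0) (by simp)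
  simp only [zero_add, ← hWν] at h1
  have h2 : HasSum (fun k => W 0 k * h 0 ^ k / k !) 1 := by
    rw [hasSum_iff_tsum_ofReal_eq _ zero_le_one, ENNReal.ofReal_one]
    · exact hone
    · intro k
      have := hW 0 k
      have := hpos 0
      positivity
  have h3 := (h2.congr_fun (g := fun k => h 0 ^ k / k ! * W 0 k) (fun k => by ring)).unique h1
  simp only [pow_zero, zero_mul, neg_zero, Real.exp_zero, mul_one, integral_const, smul_eq_mul] at h3
  exact (ENNReal.toReal_eq_one_iff _).1 h3.symm

lemma risingFac_succ (x : ℝ) (n : ℕ) : risingFac x (n + 1) = risingFac x n * (x + n) :=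
  Finset.prod_range_succ _ _

lemma risingFac_succ' (x : ℝ) (n : ℕ) : risingFac x (n + 1) = x * risingFac (x + 1) n := by
  rw [risingFac, Finset.prod_range_succ', mul_comm, risingFac]
  congr 1
  · simp
  · refine Finset.prod_congr rfl fun i _ => ?_
    push_cast
    ring

lemma risingFac_pos {x : ℝ} (hx : 0 < x) (n : ℕ) : 0 < risingFac x n :=
  Finset.prod_pos fun i _ => by positivity

/-- The exponential rate of the weights `VIBP 0 θ γ (n + 1)`. -/
noncomputable def ibpRate (θ : ℝ) (n : ℕ) : ℝ := ∑ i ∈ Finset.range (n + 1), θ / (θ + i)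

lemma ibpRate_zero {θ : ℝ} (hθ : 0 < θ) : ibpRate θ 0 = 1 := by
  simp [ibpRate, hθ.ne']

lemma ibpRate_succ (θ : ℝ) (n : ℕ) :
    ibpRate θ (n + 1) = ibpRate θ n + θ / (θ + (n + 1 : ℕ)) :=
  Finset.sum_range_succ _ _

lemma ibpRate_monotone {θ : ℝ} (hθ : 0 < θ) : Monotone (ibpRate θ) :=
  monotone_nat_of_le_succ fun n => by
    rw [ibpRate_succ]
    have : 0 ≤ θ / (θ + (n + 1 : ℕ)) := by positivity
    linarith

lemma ibpRate_pos {θ : ℝ} (hθ : 0 < θ) (n : ℕ) : 0 < ibpRate θ n :=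
  (zero_lt_one.trans_eq (ibpRate_zero hθ).symm).trans_le (ibpRate_monotone hθ n.zero_le)

lemma tendsto_ibpRate {θ : ℝ} (hθ : 0 < θ) : Tendsto (ibpRate θ) atTop atTop := by
  have hc : 0 < θ / (θ + 1) := by positivity
  have h1 := Real.tendsto_sum_range_one_div_nat_succ_atTop.const_mul_atTop hc
  refine tendsto_atTop_mono (fun n => ?_) (h1.comp (tendsto_add_atTop_nat 1))
  simp only [Function.comp_apply, ibpRate, Finset.mul_sum]
  refine Finset.sum_le_sum fun i _ => ?_
  rw [_root_.div_mul_div_comm, mul_one]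
  gcongr
  have : (0 : ℝ) ≤ θ * i := by positivity
  nlinarith

lemma VIBP_zero_eq {θ : ℝ} (hθ : 0 < θ) (γ : ℝ) (n k : ℕ) :
    VIBP 0 θ γ (n + 1) k =
      (1 / (risingFac (θ + 1) n ^ k * k !)) * (γ ^ k * Real.exp (-(ibpRate θ n * γ))) := by
  have hrate : ∑ i ∈ Finset.Icc 1 (n + 1),
      γ * risingFac (0 + θ) (i - 1) / risingFac (1 + θ) (i - 1) = ibpRate θ n * γ := by
    rw [ibpRate, Finset.sum_mul, Finset.range_eq_Ico, Finset.sum_Ico_eq_sum_range,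
      ← Finset.Ico_succ_right_eq_Icc, Finset.sum_Ico_eq_sum_range]
    refine Finset.sum_congr rfl fun i _ => ?_
    have h1 : 0 < risingFac (θ + 1) i := risingFac_pos (by positivity) i
    have h2 : risingFac θ i * (θ + i) = θ * risingFac (θ + 1) i := by
      rw [← risingFac_succ, risingFac_succ']
    rw [add_tsub_cancel_left, zero_add, zero_add, add_comm 1 θ]
    have h3 : 0 < θ + (i : ℝ) := by positivity
    field_simp
    linear_combination γ * h2
  rw [VIBP, hrate, add_tsub_cancel_right, div_pow]
  field_simp

/-- In the normalization `V (n + 1) k * (θ + 1)_{n↑} ^ k * k!`, the recursion for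
`(0, θ)`-solutions becomes a Taylor shift by the increments of `ibpRate θ`. -/
lemma isSolution_zero_iff {θ : ℝ} (hθ : 0 < θ) (V W : ℕ → ℕ → ℝ)
    (hW : ∀ n k, W n k = V (n + 1) k * (risingFac (θ + 1) n ^ k * k !)) :
    IsSolution 0 θ V ↔ HasSum (fun k => W 0 k * ibpRate θ 0 ^ k / k !) 1 ∧
      ∀ n k, HasSum (fun j => (ibpRate θ (n + 1) - ibpRate θ n) ^ j / j ! * W (n + 1) (k + j))
        (W n k) := by
  have h0 : ∀ k, W 0 k * ibpRate θ 0 ^ k / k ! = V 1 k := fun k => by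
    have : (k ! : ℝ) ≠ 0 := by positivity
    rw [hW, ibpRate_zero hθ]
    simp [risingFac, this]
  have hstep : ∀ n k, (HasSum (fun j : ℕ => (Nat.choose (k + j) j : ℝ) *
        (risingFac (θ + 0) (n + 1)) ^ j * (θ + ((n + 1 : ℕ) : ℝ)) ^ k * V (n + 1 + 1) (k + j))
        (V (n + 1) k) ↔
      HasSum (fun j => (ibpRate θ (n + 1) - ibpRate θ n) ^ j / j ! * W (n + 1) (k + j))
        (W n k)) := fun n k => by
    have hc : 0 < risingFac (θ + 1) n := risingFac_pos (by positivity) n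
    have hck : risingFac (θ + 1) n ^ k * (k ! : ℝ) ≠ 0 := by positivity
    rw [← hasSum_mul_right_iff hck, ← hW]
    refine iff_of_eq (congrArg (HasSum · (W n k)) (funext fun j => ?_))
    have hfac : ((k + j).choose j : ℝ) * k ! * j ! = (k + j)! := by
      exact_mod_cast Nat.add_choose_mul_factorial_mul_factorial k j
    have hd : 0 < θ + ((n + 1 : ℕ) : ℝ) := by positivity
    have hr : risingFac (θ + 1) (n + 1) = risingFac (θ + 1) n * (θ + ((n + 1 : ℕ) : ℝ)) := by
      rw [risingFac_succ]
      push_cast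
      ring
    rw [hW, add_zero, risingFac_succ', hr, ibpRate_succ, add_sub_cancel_left, ← hfac,
      mul_pow, mul_pow, div_pow, pow_add, pow_add]
    field_simp
  rw [IsSolution]
  simp_rw [h0]
  refine and_congr_right fun _ => ⟨fun h n k => (hstep n k).1 (h (n + 1) n.succ_pos k),
    fun h n hn k => ?_⟩
  obtain ⟨n, rfl⟩ := Nat.exists_eq_succ_of_ne_zero (Nat.one_le_iff_ne_zero.1 hn)
  exact (hstep n k).2 (h n k)

/-- Theorem 1.1, case `α = 0`: solutions are exactly mixtures of 2-parameter
IBP weights over `γ`. -/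
theorem stmt_5
    (θ : ℝ) (hθ : 0 < θ)
    (V : ℕ → ℕ → ℝ) (hVnonneg : ∀ n k, 0 ≤ V n k) :
    IsSolution 0 θ V ↔
      ∃ μ : Measure ℝ, IsProbabilityMeasure μ ∧ μ (Set.Iio 0) = 0 ∧
        ∀ n : ℕ, 1 ≤ n → ∀ k : ℕ, V n k = ∫ γ, VIBP 0 θ γ n k ∂μ := by
  set W : ℕ → ℕ → ℝ := fun n k => V (n + 1) k * (risingFac (θ + 1) n ^ k * k !) with hWdef
  have hc : ∀ n, 0 < risingFac (θ + 1) n := risingFac_pos (by positivity)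
  have hmix : ∀ μ : Measure ℝ, (∀ n : ℕ, 1 ≤ n → ∀ k : ℕ, V n k = ∫ γ, VIBP 0 θ γ n k ∂μ) ↔
      ∀ n k, W n k = ∫ γ, γ ^ k * Real.exp (-(ibpRate θ n * γ)) ∂μ := fun μ => by
    have hone : ∀ n k, V (n + 1) k = ∫ γ, VIBP 0 θ γ (n + 1) k ∂μ ↔
        W n k = ∫ γ, γ ^ k * Real.exp (-(ibpRate θ n * γ)) ∂μ := fun n k => by
      have hck : 0 < risingFac (θ + 1) n ^ k * (k ! : ℝ) := by
        have := hc n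
        positivity
      simp_rw [VIBP_zero_eq hθ, integral_const_mul, hWdef]
      rw [one_div_mul_eq_div, eq_div_iff hck.ne']
    refine ⟨fun h n k => (hone n k).1 (h (n + 1) n.succ_pos k), fun h n hn k => ?_⟩
    obtain ⟨n, rfl⟩ := Nat.exists_eq_succ_of_ne_zero (Nat.one_le_iff_ne_zero.1 hn)
    exact (hone n k).2 (h n k)
  have hW : ∀ n k, 0 ≤ W n k := fun n k => by
    have := hc n
    have := hVnonneg (n + 1) k
    positivity
  have hpos := ibpRate_pos hθ
  have hmono := ibpRate_monotone hθ
  rw [isSolution_zero_iff hθ V W fun _ _ => rfl]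
  simp_rw [hmix]
  constructor
  · rintro ⟨h1, hrec⟩
    refine exists_measure_of_expGenFun hW hpos hmono (tendsto_ibpRate hθ) ?_ hrec
    rw [hasSum_iff_tsum_ofReal_eq _ zero_le_one, ENNReal.ofReal_one] at h1
    · exact h1
    · intro k
      have := hW 0 k
      have := hpos 0
      positivity
  · rintro ⟨μ, _, hμ0, hμ⟩
    refine ⟨?_, fun n k => ?_⟩
    · have h1 := hasSum_integral_pow_mul_exp_neg hμ0 (hpos 0).le (h := 0) (k := 0) (by simp)
      simp only [zero_add, ← hμ] at h1
      convert! h1 using 1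
      · funext k
        ring
      · simp
    · have h1 := hasSum_integral_pow_mul_exp_neg hμ0 (sub_nonneg.2 (hmono n.le_succ))
        (integrable_pow_mul_exp_neg hμ0 (hpos n) k)
      rw [add_sub_cancel] at h1
      simpa only [← hμ] using h1
end
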